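/- There is an absolute constant C such that for all sufficiently large n the following holds. Let G be a finite simple graph on n vertices and let π be a uniformly random permutation of its vertices. Then for any vertex v, conditioned on the π-position of v being at least n/2, the probability that v has a neighbor in the remaining graph G_{π(v)} (taken at v's own position) whose π-position lies in the same shell as v is at most C/log n. -/

import Mathlib

open Finset

/-- `lfmisAux W E π i` : the vertex at π-position `i` is in the greedy
lexicographically-first MIS of the graph with vertex set `W` and edge set `E`. -/
def lfmisAux {n : ℕ} (W : Set (Fin n)) (E : Set (Sym2 (Fin n))) (π : Equiv.Perm (Fin n))
    (i : ℕ) : Prop :=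
  (∃ h : i < n, π ⟨i, h⟩ ∈ W) ∧
    ∀ j, j < i →
      (∃ (h1 : j < n) (h2 : i < n), π ⟨j, h1⟩ ∈ W ∧ π ⟨i, h2⟩ ∈ W ∧
        s(π ⟨j, h1⟩, π ⟨i, h2⟩) ∈ E) → ¬ lfmisAux W E π j
termination_by i

/-- The lexicographically-first MIS of the graph with vertex set `W ⊆ Fin n`
and edge set `E`, under the permutation `π` (position `i` holds vertex `π i`). -/
def LFMISOn {n : ℕ} (W : Set (Fin n)) (E : Set (Sym2 (Fin n)))
    (π : Equiv.Perm (Fin n)) : Set (Fin n) :=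
  {v | v ∈ W ∧ lfmisAux W E π (π.symm v : ℕ)}

/-- State of the `InfluenceMIS` procedure: alive vertices, surviving edges,
undecided vertices, undecided edges. -/
structure MISState (n : ℕ) where
  verts : Finset (Fin n)
  edges : Finset (Sym2 (Fin n))
  uV : Finset (Fin n)
  uE : Finset (Sym2 (Fin n))

/-- Current neighbors of `u`. -/
def MISState.nbrs {n : ℕ} (st : MISState n) (u : Fin n) : Finset (Fin n) :=
  st.verts.filter fun v => v ≠ u ∧ s(u, v) ∈ st.edges

/-- One iteration of `InfluenceMIS`, processing vertex `u`.  If `u` is not alive,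
nothing happens.  If `u` is undecided, all of its neighbors become undecided and
`u` is deleted (it joins the influence set).  Otherwise `u` is (implicitly) added
to the MIS: its neighbors along undecided edges become undecided, its neighbors
along decided edges are deleted, and `u` is deleted. -/
def stepInf {n : ℕ} (st : MISState n) (u : Fin n) : MISState n :=
  if u ∉ st.verts then st
  else if u ∈ st.uV then
    { verts := st.verts.erase u
      edges := st.edges.filter fun e => u ∉ e
      uV := (st.uV ∪ st.nbrs u).erase u
      uE := st.uE.filter fun e => u ∉ e }
  else
    let D := (st.nbrs u).filter fun v => s(u, v) ∉ st.uE
    let U := (st.nbrs u).filter fun v => s(u, v) ∈ st.uE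
    { verts := (st.verts.erase u) \ D
      edges := st.edges.filter fun e => u ∉ e ∧ ∀ v ∈ D, v ∉ e
      uV := ((st.uV ∪ U) \ D).erase u
      uE := st.uE.filter fun e => u ∉ e ∧ ∀ v ∈ D, v ∉ e }

/-- `stateAt π st0 i` : the state at the beginning of (0-based) iteration `i`
of `InfluenceMIS` started from `st0`, where position `i` holds vertex `π i`
(so 1-based iteration `i` of the paper corresponds to `stateAt π st0 (i-1)`). -/
def stateAt {n : ℕ} (π : Equiv.Perm (Fin n)) (st0 : MISState n) : ℕ → MISState n
  | 0 => st0
  | i + 1 => if h : i < n then stepInf (stateAt π st0 i) (π ⟨i, h⟩) else stateAt π st0 i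

/-- The influence set returned by `InfluenceMIS`: vertices that are alive and
undecided at the beginning of their own iteration. -/
def influenceMIS {n : ℕ} (π : Equiv.Perm (Fin n)) (st0 : MISState n) : Finset (Fin n) :=
  Finset.univ.filter fun v =>
    v ∈ (stateAt π st0 (π.symm v : ℕ)).verts ∧ v ∈ (stateAt π st0 (π.symm v : ℕ)).uV

/-- Initial state of `InfluenceMIS` on a graph `G` with undecided vertices `uV`
and undecided edges `uE`. -/
def initState {n : ℕ} (G : SimpleGraph (Fin n)) [DecidableRel G.Adj]
    (uV : Finset (Fin n)) (uE : Finset (Sym2 (Fin n))) : MISState n :=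
  ⟨Finset.univ, G.edgeFinset, uV, uE⟩

/-- Size of the `i`-th shell (1-based): `s_i = (1 + 1/log² n)^(i-1)`,
where `log` is the base-2 logarithm. -/
noncomputable def shellSize (n : ℕ) (i : ℕ) : ℝ :=
  (1 + 1 / (Real.logb 2 n) ^ 2) ^ (i - 1)

/-- Starting position of the `i`-th shell:
`p_i = 1 + log² n · (s_i - 1) = 1 + Σ_{j=1}^{i-1} s_j`. -/
noncomputable def shellStart (n : ℕ) (i : ℕ) : ℝ :=
  1 + (Real.logb 2 n) ^ 2 * (shellSize n i - 1)

/-- The first integer position of shell `i`. -/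
noncomputable def shellStartNat (n : ℕ) (i : ℕ) : ℕ := ⌈shellStart n i⌉₊

/-- The (1-based) position `q` lies in shell `i`. -/
def inShell (n : ℕ) (i : ℕ) (q : ℕ) : Prop :=
  shellStartNat n i ≤ q ∧ q < shellStartNat n (i + 1)

/-- The (1-based) positions `q` and `r` lie in the same shell. -/
def sameShell (n : ℕ) (q r : ℕ) : Prop :=
  ∃ i : ℕ, 1 ≤ i ∧ inShell n i q ∧ inShell n i r

/-- The invariant kept by the procedure when it starts with nothing undecided. -/
def MISState.Decided {n : ℕ} (st : MISState n) : Prop :=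
  st.uV = ∅ ∧ st.uE = ∅ ∧ ∀ e ∈ st.edges, ∀ u ∈ e, u ∈ st.verts

theorem MISState.Decided.stepInf {n : ℕ} {st : MISState n} (hst : st.Decided) (u : Fin n) :
    (stepInf st u).Decided := by
  obtain ⟨h1, h2, h3⟩ := hst
  unfold _root_.stepInf
  split_ifs with hu hv
  · simp [h1] at hv
  · refine ⟨by simp [h1, h2], by simp [h2], ?_⟩
    intro e he x hx
    simp only [mem_filter] at he
    simp only [mem_sdiff, mem_erase]
    refine ⟨⟨?_, h3 e he.1 x hx⟩, fun hD => he.2.2 x (mem_filter.1 hD) hx⟩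
    rintro rfl
    exact he.2.1 hx
  · exact ⟨h1, h2, h3⟩

theorem stepInf_verts_subset {n : ℕ} (st : MISState n) (u : Fin n) :
    (stepInf st u).verts ⊆ st.verts := by
  unfold stepInf
  split_ifs
  · exact erase_subset _ _
  · exact sdiff_subset.trans (erase_subset _ _)
  · exact subset_rfl

theorem notMem_stepInf_verts {n : ℕ} (st : MISState n) (u : Fin n) :
    u ∉ (stepInf st u).verts := by
  unfold stepInf
  split_ifs with hu
  · simp
  · simp
  · exact hu

/-- Processing a neighbor of `v` removes `v`. -/
theorem MISState.Decided.notMem_stepInf_verts {n : ℕ} {st : MISState n} (hst : st.Decided)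
    {v w : Fin n} (hw : w ∈ st.nbrs v) : v ∉ (_root_.stepInf st w).verts := by
  obtain ⟨h1, h2, h3⟩ := hst
  simp only [MISState.nbrs, mem_filter] at hw
  obtain ⟨hw, hne, he⟩ := hw
  have hv : v ∈ st.verts := h3 _ he v (by simp)
  unfold _root_.stepInf
  simp [hw, h1, h2, MISState.nbrs, hv, Ne.symm hne, Sym2.eq_swap (a := w), he]

theorem stateAt_decided {n : ℕ} (π : Equiv.Perm (Fin n)) {st : MISState n} (hst : st.Decided)
    (i : ℕ) : (stateAt π st i).Decided := by
  induction i with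
  | zero => exact hst
  | succ i ih =>
    rw [stateAt]
    split_ifs
    · exact ih.stepInf _
    · exact ih

theorem stateAt_verts_antitone {n : ℕ} (π : Equiv.Perm (Fin n)) (st : MISState n) :
    Antitone fun i => (stateAt π st i).verts := by
  refine antitone_nat_of_succ_le fun i => ?_
  rw [stateAt]
  split_ifs
  · exact stepInf_verts_subset _ _
  · exact le_rfl

theorem le_symm_of_mem_stateAt_verts {n : ℕ} {π : Equiv.Perm (Fin n)} {st : MISState n} {i : ℕ}
    {w : Fin n} (hw : w ∈ (stateAt π st i).verts) : i ≤ (π.symm w : ℕ) := by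
  by_contra! h
  have h1 : w ∈ (stateAt π st ((π.symm w : ℕ) + 1)).verts :=
    stateAt_verts_antitone π st (Nat.succ_le_of_lt h) hw
  rw [stateAt, dif_pos (π.symm w).2] at h1
  simp only [Fin.eta, Equiv.apply_symm_apply] at h1
  exact notMem_stepInf_verts _ _ h1

theorem stateAt_congr {n : ℕ} {π ρ : Equiv.Perm (Fin n)} (st : MISState n) {i : ℕ}
    (h : ∀ j : Fin n, (j : ℕ) < i → π j = ρ j) : stateAt π st i = stateAt ρ st i := by
  induction i with
  | zero => rfl
  | succ i ih =>
    rw [stateAt, stateAt, ih fun j hj => h j (by omega)]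
    split_ifs with hi
    · rw [h ⟨i, hi⟩ (Nat.lt_succ_self i)]
    · rfl

theorem initState_decided {n : ℕ} (G : SimpleGraph (Fin n)) [DecidableRel G.Adj] :
    (initState G ∅ ∅).Decided :=
  ⟨rfl, rfl, fun _ _ _ _ => mem_univ _⟩

open scoped Classical in
/-- The permutations in which the vertex `k` positions after `v` is a neighbor of `v` in the
graph remaining at `v`'s position. -/
noncomputable def nbrAtOffset {n : ℕ} (st : MISState n) (v : Fin n) (k : ℕ) :
    Finset (Equiv.Perm (Fin n)) :=
  univ.filter fun π => ∃ h : (π.symm v : ℕ) + k < n,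
    π ⟨(π.symm v : ℕ) + k, h⟩ ∈ (stateAt π st (π.symm v : ℕ)).nbrs v

theorem mem_nbrAtOffset {n : ℕ} {st : MISState n} {v : Fin n} {k : ℕ} {π : Equiv.Perm (Fin n)} :
    π ∈ nbrAtOffset st v k ↔ ∃ h : (π.symm v : ℕ) + k < n,
      π ⟨(π.symm v : ℕ) + k, h⟩ ∈ (stateAt π st (π.symm v : ℕ)).nbrs v := by
  simp [nbrAtOffset]

/-- The positions after `v` are exchangeable given the graph remaining at `v`'s position. -/
theorem card_nbrAtOffset_le {n : ℕ} (st : MISState n) (v : Fin n) {k : ℕ} (hk : 1 ≤ k) :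
    (nbrAtOffset st v k).card ≤ (nbrAtOffset st v 1).card := by
  classical
  let pos : Equiv.Perm (Fin n) → ℕ → Fin n := fun π l =>
    if h : (π.symm v : ℕ) + l < n then ⟨(π.symm v : ℕ) + l, h⟩ else v
  let f : Equiv.Perm (Fin n) → Equiv.Perm (Fin n) := fun π =>
    π * Equiv.swap (pos π 1) (pos π k)
  have hpos : ∀ π ∈ nbrAtOffset st v k, ∀ j : Fin n, (j : ℕ) ≤ π.symm v →
      Equiv.swap (pos π 1) (pos π k) j = j := by
    intro π hπ j hj
    obtain ⟨h, -⟩ := mem_nbrAtOffset.1 hπ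
    have h1 : (π.symm v : ℕ) + 1 < n := by omega
    apply Equiv.swap_apply_of_ne_of_ne
    · simp only [pos, dif_pos h1, ne_eq, Fin.ext_iff]
      omega
    · simp only [pos, dif_pos h, ne_eq, Fin.ext_iff]
      omega
  have hsymm : ∀ π ∈ nbrAtOffset st v k, (f π).symm v = π.symm v := by
    intro π hπ
    rw [Equiv.symm_apply_eq]
    simp [f, Equiv.Perm.mul_apply, hpos π hπ _ le_rfl]
  refine card_le_card_of_injOn f ?_ ?_
  · intro π hπ
    have hs := hsymm π hπ
    obtain ⟨h, hm⟩ := mem_nbrAtOffset.1 hπ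
    have h1 : (π.symm v : ℕ) + 1 < n := by omega
    refine mem_coe.2 (mem_nbrAtOffset.2 ?_)
    rw [hs]
    refine ⟨h1, ?_⟩
    rw [stateAt_congr st (ρ := π)]
    · simpa [f, pos, h, h1, Equiv.Perm.mul_apply] using hm
    · intro j hj
      simp [f, Equiv.Perm.mul_apply, hpos π hπ j hj.le]
  · intro π hπ ρ hρ hf
    have h : π.symm v = ρ.symm v := by
      rw [← hsymm π hπ, ← hsymm ρ hρ, hf]
    have hp : pos π = pos ρ := by
      funext l
      simp only [pos, h]
    simpa only [f, hp, mul_left_inj] using hf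

open scoped Classical in
theorem card_filter_apply_eq {n : ℕ} (p q v : Fin n) :
    (univ.filter fun π : Equiv.Perm (Fin n) => π p = v).card ≤
      (univ.filter fun π : Equiv.Perm (Fin n) => π q = v).card := by
  refine card_le_card_of_injOn (fun π => π * Equiv.swap p q) ?_ ?_
  · intro π hπ
    simpa [Equiv.Perm.mul_apply] using hπ
  · intro π _ ρ _ h
    simpa using h

open scoped Classical in
/-- Removing `v` from the order, at most one insertion place of `v` puts it right before a
neighbor of `v` in the graph remaining at that place. -/
theorem card_nbrAtOffset_one_le {n : ℕ} [NeZero n] {st : MISState n} (hst : st.Decided)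
    (v : Fin n) :
    (nbrAtOffset st v 1).card ≤
      (univ.filter fun π : Equiv.Perm (Fin n) => π 0 = v).card := by
  have key : ∀ π ∈ nbrAtOffset st v 1, ∀ ρ ∈ nbrAtOffset st v 1,
      π * (Fin.cycleRange (π.symm v))⁻¹ = ρ * (Fin.cycleRange (ρ.symm v))⁻¹ →
      ¬ π.symm v < ρ.symm v := by
    intro π hπ ρ hρ h hlt
    obtain ⟨h1, hm⟩ := mem_nbrAtOffset.1 hπ
    obtain ⟨_, hm'⟩ := mem_nbrAtOffset.1 hρ
    have hρ' : ρ = π * (Fin.cycleRange (π.symm v))⁻¹ * Fin.cycleRange (ρ.symm v) := by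
      rw [h]; simp
    set i := π.symm v with hi
    set i' := ρ.symm v with hi'
    have hlt' : (i : ℕ) < i' := hlt
    have hagree : ∀ j : Fin n, (j : ℕ) < i → ρ j = π j := by
      intro j hj
      rw [hρ', Equiv.Perm.mul_apply,
        Fin.cycleRange_of_lt (show j < i' from hj.trans hlt'),
        ← Fin.cycleRange_of_lt (show j < i from hj), ← Equiv.Perm.mul_apply, inv_mul_cancel_right]
    have hnext : ρ i = π ⟨i + 1, h1⟩ := by
      have : i + 1 = (⟨i + 1, h1⟩ : Fin n) := by
        ext
        exact Fin.val_add_one_of_lt' h1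
      rw [hρ', Equiv.Perm.mul_apply, Equiv.Perm.mul_apply, Fin.cycleRange_of_lt hlt, this]
      congr 1
      rw [Equiv.Perm.inv_eq_iff_eq, Fin.cycleRange_of_gt]
      simp [Fin.lt_def]
    have hgone : v ∉ (stateAt ρ st (i + 1 : ℕ)).verts := by
      rw [stateAt, dif_pos i.2, Fin.eta, hnext, stateAt_congr st hagree]
      exact (stateAt_decided π hst i).notMem_stepInf_verts hm
    refine hgone (stateAt_verts_antitone ρ st (Nat.succ_le_of_lt hlt') ?_)
    exact (stateAt_decided ρ hst i').2.2 _ (mem_filter.1 hm').2.2 v (by simp)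
  refine card_le_card_of_injOn (fun π => π * (Fin.cycleRange (π.symm v))⁻¹) ?_ ?_
  · intro π _
    have : (Fin.cycleRange (π.symm v))⁻¹ 0 = π.symm v := by
      rw [Equiv.Perm.inv_eq_iff_eq, Fin.cycleRange_self]
    simp [Equiv.Perm.mul_apply, this]
  · intro π hπ ρ hρ h
    have heq : π.symm v = ρ.symm v :=
      le_antisymm (not_lt.1 (key ρ hρ π hπ h.symm)) (not_lt.1 (key π hπ ρ hρ h))
    simpa only [heq, mul_left_inj] using h

open scoped Classical in
theorem half_card_le_card_filter (n : ℕ) :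
    (n : ℝ) / 2 ≤ ((univ.filter fun p : Fin n => (n : ℝ) / 2 ≤ ((p : ℕ) + 1 : ℝ)).card : ℝ) := by
  set A := univ.filter fun p : Fin n => (n : ℝ) / 2 ≤ ((p : ℕ) + 1 : ℝ) with hA
  have h1 : Aᶜ.card ≤ A.card := by
    refine card_le_card_of_injOn Fin.rev ?_ Fin.rev_injective.injOn
    intro p hp
    simp only [hA, coe_compl, Set.mem_compl_iff, mem_coe, mem_filter, mem_univ, true_and,
      not_le] at hp ⊢
    have h2 : ((Fin.rev p : Fin n) : ℕ) + (p + 1) = n := by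
      rw [Fin.val_rev]
      omega
    have h3 : ((Fin.rev p : Fin n) : ℝ) + ((p : ℕ) + 1) = n := by exact_mod_cast h2
    linarith
  have h2 := card_add_card_compl A
  rw [Fintype.card_fin] at h2
  have h3 : (n : ℝ) ≤ 2 * A.card := by
    exact_mod_cast (by omega : n ≤ 2 * A.card)
  linarith

open scoped Classical in
/-- At least half of the positions are late, and `v` is equally likely to be at each of them. -/
theorem half_mul_card_le_card_late {n : ℕ} [NeZero n] (v : Fin n) :
    (n : ℝ) / 2 * ((univ.filter fun π : Equiv.Perm (Fin n) => π 0 = v).card : ℝ) ≤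
      ((univ.filter fun π : Equiv.Perm (Fin n) =>
        (n : ℝ) / 2 ≤ ((π.symm v : ℕ) + 1 : ℝ)).card : ℝ) := by
  set F := (univ.filter fun π : Equiv.Perm (Fin n) => π 0 = v).card with hF
  set A := univ.filter fun p : Fin n => (n : ℝ) / 2 ≤ ((p : ℕ) + 1 : ℝ) with hA
  have h : A.card * F ≤ (univ.filter fun π : Equiv.Perm (Fin n) =>
      (n : ℝ) / 2 ≤ ((π.symm v : ℕ) + 1 : ℝ)).card := by
    rw [card_eq_sum_card_fiberwise (f := fun π : Equiv.Perm (Fin n) => π.symm v) (t := A)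
      (fun π hπ => by simpa [hA] using hπ), ← smul_eq_mul]
    refine card_nsmul_le_sum _ _ _ fun p hp => (card_filter_apply_eq 0 p v).trans ?_
    refine card_le_card fun π hπ => ?_
    have hπ' : π.symm v = p := by
      rw [Equiv.symm_apply_eq]
      exact (mem_filter.1 hπ).2.symm
    simpa [hπ', hA] using hp
  calc (n : ℝ) / 2 * F ≤ A.card * F := by
        gcongr
        exact half_card_le_card_filter n
    _ ≤ _ := by exact_mod_cast h

theorem shellStart_add_one {n i : ℕ} (hn : Real.logb 2 n ≠ 0) (hi : 1 ≤ i) :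
    shellStart n (i + 1) = shellStart n i + shellSize n i := by
  obtain ⟨k, rfl⟩ := Nat.exists_eq_add_of_le' hi
  simp only [shellStart, shellSize, Nat.add_sub_cancel, pow_succ]
  field_simp
  ring

/-- Two positions `q` and `r` in the same shell satisfy `r - q < q / log² n + 2`. -/
theorem sameShell.sub_lt {n q r : ℕ} (hn : Real.logb 2 n ≠ 0) (h : sameShell n q r) :
    (r : ℝ) - q < q / (Real.logb 2 n) ^ 2 + 2 := by
  obtain ⟨i, hi, hq, hr⟩ := h
  have hq1 : shellStart n i ≤ q := Nat.ceil_le.1 hq.1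
  have hr1 : (r : ℝ) < shellStart n (i + 1) := Nat.lt_ceil.1 hr.2
  rw [shellStart_add_one hn hi] at hr1
  have hL : 0 < (Real.logb 2 n) ^ 2 := by positivity
  have hs : shellSize n i ≤ q / (Real.logb 2 n) ^ 2 + 1 := by
    rw [← sub_le_iff_le_add, le_div_iff₀ hL]
    unfold shellStart at hq1
    linarith
  linarith

open scoped Classical in
/-- There is an absolute constant `C` such that for all sufficiently large `n`,
for any graph `G` on `n` vertices and any vertex `v`: conditioned on the
π-position of `v` being at least `n/2`, the probability that `v` has a neighbor
in the remaining graph `G_{π(v)}` (taken at `v`'s own position) whose π-position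
lies in the same shell as `v` is at most `C / log n`. -/
theorem lonely_shell_high :
    ∃ C : ℝ, 0 < C ∧ ∃ N : ℕ, ∀ n : ℕ, N ≤ n →
      ∀ (G : SimpleGraph (Fin n)) [DecidableRel G.Adj], ∀ v : Fin n,
        ((Finset.univ.filter fun π : Equiv.Perm (Fin n) =>
            (n : ℝ) / 2 ≤ ((π.symm v : ℕ) + 1 : ℝ) ∧
            ∃ w ∈ (stateAt π (initState G ∅ ∅) (π.symm v : ℕ)).nbrs v,
              sameShell n ((π.symm v : ℕ) + 1) ((π.symm w : ℕ) + 1)).card : ℝ)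
          ≤ C / Real.logb 2 n *
            ((Finset.univ.filter fun π : Equiv.Perm (Fin n) =>
                (n : ℝ) / 2 ≤ ((π.symm v : ℕ) + 1 : ℝ)).card : ℝ) := by
  classical
  refine ⟨6, by norm_num, 2, fun n hn G _ v => ?_⟩
  have : NeZero n := ⟨by omega⟩
  have hn' : (2 : ℝ) ≤ n := by exact_mod_cast hn
  set L := Real.logb 2 n with hL
  have hL1 : 1 ≤ L := by
    rw [hL, Real.le_logb_iff_rpow_le (by norm_num) (by linarith)]
    simpa using hn'
  have hLn : L ≤ n := by
    rw [hL, Real.logb_le_iff_le_rpow (by norm_num) (by linarith), Real.rpow_natCast]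
    exact_mod_cast (Nat.lt_two_pow_self (n := n)).le
  set F := (univ.filter fun π : Equiv.Perm (Fin n) => π 0 = v).card with hF
  set S := ⌊(n : ℝ) / L ^ 2 + 2⌋₊ with hS
  have hcover : (univ.filter fun π : Equiv.Perm (Fin n) =>
      (n : ℝ) / 2 ≤ ((π.symm v : ℕ) + 1 : ℝ) ∧
      ∃ w ∈ (stateAt π (initState G ∅ ∅) (π.symm v : ℕ)).nbrs v,
        sameShell n ((π.symm v : ℕ) + 1) ((π.symm w : ℕ) + 1)) ⊆
      (Icc 1 S).biUnion (nbrAtOffset (initState G ∅ ∅) v) := by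
    intro π hπ
    obtain ⟨-, w, hw, hsame⟩ := (mem_filter.1 hπ).2
    obtain ⟨hwv, hne, -⟩ := mem_filter.1 hw
    have hle := le_symm_of_mem_stateAt_verts hwv
    have hne' : (π.symm w : ℕ) ≠ π.symm v := fun h => hne (π.symm.injective (Fin.ext h))
    obtain ⟨k, hk⟩ := Nat.exists_eq_add_of_le hle
    have hgap := hsame.sub_lt (by rw [← hL]; linarith)
    have hq : (((π.symm v : ℕ) + 1 : ℕ) : ℝ) ≤ n := by exact_mod_cast (π.symm v).2
    have hqn : (((π.symm v : ℕ) + 1 : ℕ) : ℝ) / L ^ 2 ≤ n / L ^ 2 := by gcongr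
    refine mem_biUnion.2 ⟨k, mem_Icc.2 ⟨by omega, ?_⟩, ?_⟩
    · refine Nat.le_floor ?_
      rw [hk] at hgap
      push_cast at hgap hqn
      linarith
    · rw [mem_nbrAtOffset, ← hk]
      exact ⟨(π.symm w).2, by simpa using hw⟩
  have hcard := (card_le_card hcover).trans <| card_biUnion_le_card_mul _ _ F fun k hk =>
    (card_nbrAtOffset_le _ v (mem_Icc.1 hk).1).trans
      (card_nbrAtOffset_one_le (initState_decided G) v)
  rw [Nat.card_Icc, Nat.add_sub_cancel] at hcard
  have hcard' := Nat.cast_le (α := ℝ).2 hcard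
  rw [Nat.cast_mul] at hcard'
  have hSle : (S : ℝ) ≤ n / L ^ 2 + 2 := Nat.floor_le (by positivity)
  have h1 : (n : ℝ) / L ^ 2 ≤ n / L := by
    gcongr
    nlinarith
  have h2 : 2 ≤ 2 * (n / L) := by
    rw [← mul_div_assoc, le_div_iff₀ (by linarith)]
    linarith
  calc _ ≤ (S : ℝ) * F := hcard'
    _ ≤ 6 / L * (n / 2) * F := by
        gcongr
        calc (S : ℝ) ≤ 3 * (n / L) := by linarith
          _ = 6 / L * (n / 2) := by ring
    _ = 6 / L * (n / 2 * F) := by ring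
    _ ≤ _ := by
        gcongr
        exact half_mul_card_le_card_late v
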